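/- For any natural number n ≥ 1, any ε > 0, and any vectors x₁, …, xₙ ∈ ℝ^{2n}, there exists a matrix A ∈ SL(2n, ℤ) such that for each i ∈ {1, …, n}, the first n coordinates of the vector xᵢA all have absolute value at most ε. -/

import Mathlib

/-- A `ℤ`-linear map from a free module of rank `m > n` to `ℝⁿ` has small nonzero vectors. -/
lemma exists_small {n m : ℕ} (hnm : n < m) {M : Type} [AddCommGroup M]
    (b : Module.Basis (Fin m) ℤ M) (φ : M →ₗ[ℤ] (Fin n → ℝ)) {ε : ℝ} (hε : 0 < ε) :
    ∃ a : M, a ≠ 0 ∧ ‖φ a‖ ≤ ε := by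
  by_contra! hcon
  have hinj : Function.Injective φ := by
    rw [injective_iff_map_eq_zero]
    intro a ha
    by_contra h0
    have := hcon a h0
    rw [ha, norm_zero] at this
    linarith
  let s : Set (Fin n → ℝ) := LinearMap.range φ
  have hspan : Submodule.span ℤ s = LinearMap.range φ := Submodule.span_eq _
  have hd : DiscreteTopology (Submodule.span ℤ s) := by
    refine discreteTopology_of_isOpen_singleton_zero ?_
    rw [Metric.isOpen_singleton_iff]
    refine ⟨ε, hε, ?_⟩
    rintro ⟨y, hy⟩ hdist
    rw [hspan] at hy
    obtain ⟨a, rfl⟩ := hy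
    by_contra hne
    have h0 : a ≠ 0 := by
      rintro rfl
      apply hne
      ext1
      simp
    have h1 := hcon a h0
    rw [Subtype.dist_eq, Submodule.coe_zero, dist_zero_right] at hdist
    exact absurd hdist (not_lt.mpr h1.le)
  have h := Real.finrank_eq_int_finrank_of_discrete hd
  have h1 : Set.finrank ℤ s = m := by
    rw [Set.finrank, hspan, ← (LinearEquiv.ofInjective φ hinj).finrank_eq,
      Module.finrank_eq_card_basis b, Fintype.card_fin]
  have h2 : Set.finrank ℝ s ≤ n := by
    have := Submodule.finrank_le (Submodule.span ℝ s)
    rw [Module.finrank_fin_fun] at this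
    exact this
  omega

/-- Every nonzero vector of a free module is a multiple of a unimodular one. -/
lemma exists_unimodular {m : ℕ} {M : Type} [AddCommGroup M]
    (b : Module.Basis (Fin m) ℤ M) (a : M) (ha : a ≠ 0) :
    ∃ (d : ℤ) (v : M) (f : M →ₗ[ℤ] ℤ), d ≠ 0 ∧ a = d • v ∧ f v = 1 := by
  obtain ⟨c, hc⟩ := Finset.gcd_eq_sum_mul Finset.univ (b.repr a)
  set d := Finset.univ.gcd (b.repr a) with hd
  have hdvd : ∀ i, d ∣ b.repr a i := fun i => Finset.gcd_dvd (Finset.mem_univ i)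
  choose w hw using hdvd
  have hav : a = d • ∑ i, w i • b i := by
    conv_lhs => rw [← b.sum_repr a]
    rw [Finset.smul_sum]
    exact Finset.sum_congr rfl fun i _ => by rw [smul_smul, hw]
  have hd0 : d ≠ 0 := by
    intro h
    apply ha
    rw [hav, h, zero_smul]
  refine ⟨d, ∑ i, w i • b i, b.constr ℤ c, hd0, hav, ?_⟩
  apply mul_left_cancel₀ hd0
  have : d * (b.constr ℤ c) (∑ i, w i • b i) = (b.constr ℤ c) a := by
    conv_rhs => rw [hav]
    rw [map_smul, smul_eq_mul]
  rw [this, mul_one, Module.Basis.constr_apply_fintype, hc]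
  simp [mul_comm]

lemma exists_basis {n : ℕ} {ε : ℝ} (hε : 0 < ε) (k : ℕ) : ∀ {m : ℕ} {M : Type} [AddCommGroup M],
    n + k ≤ m → ∀ (_ : Module.Basis (Fin m) ℤ M) (φ : M →ₗ[ℤ] (Fin n → ℝ)),
    ∃ b : Module.Basis (Fin m) ℤ M, ∀ j : Fin m, (j : ℕ) < k → ‖φ (b j)‖ ≤ ε := by
  induction k with
  | zero => intro m M _ _ b φ; exact ⟨b, fun j hj => absurd hj (Nat.not_lt_zero _)⟩
  | succ k ih =>
    intro m M _ hm b φ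
    obtain ⟨a, ha, hsmall⟩ := exists_small (by omega) b φ hε
    obtain ⟨d, v, f, hd, hav, hfv⟩ := exists_unimodular b a ha
    have hv : ‖φ v‖ ≤ ε := by
      refine le_trans ?_ hsmall
      rw [hav, map_smul, ← Int.cast_smul_eq_zsmul ℝ, norm_smul]
      refine le_mul_of_one_le_left (norm_nonneg _) ?_
      rw [Real.norm_eq_abs]
      exact_mod_cast Int.one_le_abs hd
    have hli : ∀ (c : ℤ), ∀ x ∈ LinearMap.ker f, c • v + x = 0 → c = 0 := by
      intro c x hx h
      have := congrArg f h
      rw [map_add, map_smul, hfv, LinearMap.mem_ker.mp hx] at this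
      simpa using this
    have hsp : ∀ z : M, ∃ c : ℤ, z + c • v ∈ LinearMap.ker f := by
      intro z
      refine ⟨- f z, ?_⟩
      rw [LinearMap.mem_ker, map_add, map_smul, hfv]
      simp
    obtain ⟨k', bN⟩ := Submodule.basisOfPid b (LinearMap.ker f)
    have hk : k' + 1 = m := by
      have h1 := Module.finrank_eq_card_basis (Module.Basis.mkFinCons v bN hli hsp)
      have h2 := Module.finrank_eq_card_basis b
      rw [Fintype.card_fin] at h1 h2
      omega
    subst hk
    obtain ⟨b', hb'⟩ := ih (by omega) bN (φ ∘ₗ (LinearMap.ker f).subtype)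
    refine ⟨Module.Basis.mkFinCons v b' hli hsp, ?_⟩
    intro j
    rw [Module.Basis.coe_mkFinCons]
    refine Fin.cases ?_ ?_ j
    · intro _
      simpa using hv
    · intro i hi
      have := hb' i (by simpa using hi)
      simpa using this

theorem stmt7 (n : ℕ) (hn : 1 ≤ n) (ε : ℝ) (hε : 0 < ε)
    (x : Fin n → Fin (2 * n) → ℝ) :
    ∃ A : Matrix.SpecialLinearGroup (Fin (2 * n)) ℤ,
      ∀ i : Fin n, ∀ j : Fin (2 * n), (j : ℕ) < n →
        |Matrix.vecMul (x i)
            ((A : Matrix (Fin (2 * n)) (Fin (2 * n)) ℤ).map (fun k : ℤ => (k : ℝ))) j| ≤ ε := by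
  let φ : (Fin (2 * n) → ℤ) →ₗ[ℤ] (Fin n → ℝ) := AddMonoidHom.toIntLinearMap
    { toFun := fun a i => ∑ l, x i l * (a l : ℝ)
      map_zero' := by ext i; simp
      map_add' := by intro a b; ext i; simp [mul_add, Finset.sum_add_distrib] }
  obtain ⟨b, hb⟩ := exists_basis hε n (by omega) (Pi.basisFun ℤ (Fin (2 * n))) φ
  let B : Matrix (Fin (2 * n)) (Fin (2 * n)) ℤ := (Pi.basisFun ℤ (Fin (2 * n))).toMatrix b
  have hB : ∀ l j, B l j = b j l := fun l j => by simp [B, Module.Basis.toMatrix_apply]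
  have hdet : IsUnit B.det := by
    have := (Pi.basisFun ℤ (Fin (2 * n))).isUnit_det b
    rwa [Module.Basis.det_apply] at this
  have hsq : B.det * B.det = 1 := Int.isUnit_mul_self hdet
  let p : Fin (2 * n) := ⟨2 * n - 1, by omega⟩
  refine ⟨⟨B.updateCol p (B.det • fun l => B l p), ?_⟩, ?_⟩
  · rw [Matrix.det_updateCol_smul]
    have : B.updateCol p (fun l => B l p) = B := Matrix.updateCol_eq_self B p
    rw [this, hsq]
  · intro i j hj
    have hjp : j ≠ p := by
      intro h
      have := congrArg Fin.val h
      simp only [p] at this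
      omega
    refine le_trans (le_of_eq ?_) ((norm_le_pi_norm (φ (b j)) i).trans (hb j hj))
    rw [Real.norm_eq_abs]
    congr 1
    simp only [Matrix.vecMul, dotProduct, Matrix.map_apply, Matrix.updateCol_ne hjp, hB]
    rfl
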